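/- arXiv:2501.16620 — 5 statements merged into one kernel-verified Lean document; each statement's English description precedes it below -/
import Mathlib

section
/- Let k ≥ 3 be an integer and let n be a nonzero integer. If X > 4^{6(k−1)} · |n|^{6k}, then there do not exist positive integers a₁, a₂, b₁, b₂ with X^{1/3} < a₁ < a₂ ≤ X^{1/2} < b₁ < b₂ ≤ X such that a_i·b_j + n is a k-th power of a positive integer for all 1 ≤ i, j ≤ 2. -/
theorem pow_pred_le_abs_pow_sub_pow {k u v : ℕ} (hk : k ≠ 0) (huv : u ≠ v) {A : ℝ} (hA : 0 ≤ A)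
    (hu : A ≤ (u : ℝ) ^ k) (hv : A ≤ (v : ℝ) ^ k) :
    A ^ (k - 1) ≤ |(u : ℝ) ^ k - (v : ℝ) ^ k| ^ k := by
  wlog h : v < u generalizing u v
  · rw [abs_sub_comm]
    exact this huv.symm hv hu (by omega)
  have hgap : (v : ℝ) ^ (k - 1) ≤ (u : ℝ) ^ k - (v : ℝ) ^ k := by
    have hvu : (v : ℝ) + 1 ≤ u := by exact_mod_cast h
    have hpow : (v : ℝ) ^ (k - 1) ≤ (u : ℝ) ^ (k - 1) := by gcongr
    rw [← pow_sub_one_mul hk (u : ℝ), ← pow_sub_one_mul hk (v : ℝ)]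
    have hmul : (v : ℝ) ^ (k - 1) * (v + 1) ≤ (u : ℝ) ^ (k - 1) * u := by gcongr
    linarith
  calc A ^ (k - 1) ≤ ((v : ℝ) ^ k) ^ (k - 1) := by gcongr
    _ = ((v : ℝ) ^ (k - 1)) ^ k := pow_right_comm _ _ _
    _ ≤ |(u : ℝ) ^ k - (v : ℝ) ^ k| ^ k := by
      gcongr
      exact hgap.trans (le_abs_self _)

/-- The gap principle: the products `a₁b₁ + n`, `a₂b₂ + n` and `a₁b₂ + n`, `a₂b₁ + n` of `k`-th
powers are distinct `k`-th powers, so their difference `n(a₂ - a₁)(b₂ - b₁)` is large. -/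
theorem gap_of_shifted_products_eq_pow {k p q r s : ℕ} (hk : k ≠ 0) {n a₁ a₂ b₁ b₂ : ℝ}
    (hn : n ≠ 0) (ha₁ : 0 < a₁) (ha : a₁ < a₂) (hb₁ : 0 < b₁) (hb : b₁ < b₂)
    (hsmall : 2 * |n| ≤ a₁ * b₁)
    (hp : a₁ * b₁ + n = (p : ℝ) ^ k) (hq : a₂ * b₂ + n = (q : ℝ) ^ k)
    (hr : a₁ * b₂ + n = (r : ℝ) ^ k) (hs : a₂ * b₁ + n = (s : ℝ) ^ k) :
    (a₁ * b₁) ^ (k - 1) ≤ 4 ^ (k - 1) * |n| ^ k * (a₂ * b₂) := by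
  have ha₂ : 0 < a₂ := ha₁.trans ha
  have hb₂ : 0 < b₂ := hb₁.trans hb
  have hn' : -|n| ≤ n := neg_abs_le n
  have h11 : 0 < a₁ * b₁ := mul_pos ha₁ hb₁
  have h12 : a₁ * b₁ ≤ a₁ * b₂ := by gcongr
  have h21 : a₁ * b₁ ≤ a₂ * b₁ := by gcongr
  have h22 : a₁ * b₁ ≤ a₂ * b₂ := by gcongr
  have hpq : ((p * q : ℕ) : ℝ) ^ k = (a₁ * b₁ + n) * (a₂ * b₂ + n) := by
    rw [hp, hq]; push_cast; ring
  have hrs : ((r * s : ℕ) : ℝ) ^ k = (a₁ * b₂ + n) * (a₂ * b₁ + n) := by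
    rw [hr, hs]; push_cast; ring
  have hsub : ((p * q : ℕ) : ℝ) ^ k - ((r * s : ℕ) : ℝ) ^ k = n * ((a₂ - a₁) * (b₂ - b₁)) := by
    rw [hpq, hrs]; ring
  have hne : p * q ≠ r * s := by
    intro h
    rw [h, sub_self] at hsub
    exact mul_ne_zero hn (mul_pos (sub_pos.2 ha) (sub_pos.2 hb)).ne' hsub.symm
  have hle₁ : a₁ * b₁ * (a₂ * b₂) / 4 ≤ ((p * q : ℕ) : ℝ) ^ k := by
    rw [hpq]
    calc a₁ * b₁ * (a₂ * b₂) / 4 = (a₁ * b₁ / 2) * (a₂ * b₂ / 2) := by ring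
      _ ≤ _ := by gcongr <;> linarith
  have hle₂ : a₁ * b₁ * (a₂ * b₂) / 4 ≤ ((r * s : ℕ) : ℝ) ^ k := by
    rw [hrs]
    calc a₁ * b₁ * (a₂ * b₂) / 4 = (a₁ * b₂ / 2) * (a₂ * b₁ / 2) := by ring
      _ ≤ _ := by gcongr <;> linarith
  have hkey := pow_pred_le_abs_pow_sub_pow hk hne (by positivity) hle₁ hle₂
  have habs : |n * ((a₂ - a₁) * (b₂ - b₁))| ≤ |n| * (a₂ * b₂) := by
    rw [abs_mul, abs_of_pos (mul_pos (sub_pos.2 ha) (sub_pos.2 hb))]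
    have : 0 ≤ b₂ - b₁ := (sub_pos.2 hb).le
    gcongr <;> linarith
  rw [hsub] at hkey
  have hbound : (a₁ * b₁ * (a₂ * b₂) / 4) ^ (k - 1) ≤ (|n| * (a₂ * b₂)) ^ k :=
    hkey.trans (by gcongr)
  rw [div_pow, div_le_iff₀ (by positivity), mul_pow, mul_pow |n|,
    ← pow_sub_one_mul hk (a₂ * b₂)] at hbound
  refine le_of_mul_le_mul_right ?_ (show 0 < (a₂ * b₂) ^ (k - 1) by positivity)
  linarith

/-- Corollary 2.4: if `X > 4^{6(k-1)} |n|^{6k}`, then there do not exist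
`X^{1/3} < a₁ < a₂ ≤ X^{1/2} < b₁ < b₂ ≤ X` with every `aᵢbⱼ + n` a `k`-th power. -/
theorem no_K22_in_ranges (k : ℕ) (n : ℤ) (hk : 3 ≤ k) (hn : n ≠ 0)
    (X : ℝ) (hX : 4 ^ (6 * (k - 1)) * |(n : ℝ)| ^ (6 * k) < X) :
    ¬ ∃ a₁ a₂ b₁ b₂ : ℕ,
      X ^ ((1 : ℝ) / 3) < (a₁ : ℝ) ∧ a₁ < a₂ ∧ (a₂ : ℝ) ≤ X ^ ((1 : ℝ) / 2) ∧
      X ^ ((1 : ℝ) / 2) < (b₁ : ℝ) ∧ b₁ < b₂ ∧ (b₂ : ℝ) ≤ X ∧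
      (∀ a ∈ ({a₁, a₂} : Set ℕ), ∀ b ∈ ({b₁, b₂} : Set ℕ),
        ∃ x : ℕ, 0 < x ∧ (a * b : ℤ) + n = (x : ℤ) ^ k) := by
  rintro ⟨a₁, a₂, b₁, b₂, ha₁, ha, ha₂, hb₁, hb, hb₂, hpow⟩
  obtain ⟨p, -, hp⟩ := hpow a₁ (by simp) b₁ (by simp)
  obtain ⟨q, -, hq⟩ := hpow a₂ (by simp) b₂ (by simp)
  obtain ⟨r, -, hr⟩ := hpow a₁ (by simp) b₂ (by simp)
  obtain ⟨s, -, hs⟩ := hpow a₂ (by simp) b₁ (by simp)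
  have hX₀ : 0 ≤ X := le_trans (by positivity) hX.le
  obtain ⟨t, ht₀, rfl⟩ : ∃ t : ℝ, 0 ≤ t ∧ t ^ 6 = X :=
    ⟨X ^ ((6 : ℕ) : ℝ)⁻¹, by positivity, Real.rpow_inv_natCast_pow hX₀ (by norm_num)⟩
  have hthird : (t ^ 6) ^ ((1 : ℝ) / 3) = t ^ 2 := by
    rw [← Real.rpow_natCast, ← Real.rpow_mul ht₀, ← Real.rpow_natCast]; norm_num
  have hhalf : (t ^ 6) ^ ((1 : ℝ) / 2) = t ^ 3 := by
    rw [← Real.rpow_natCast, ← Real.rpow_mul ht₀, ← Real.rpow_natCast]; norm_num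
  rw [hthird] at ha₁
  rw [hhalf] at ha₂ hb₁
  have ht : 4 ^ (k - 1) * |(n : ℝ)| ^ k < t := by
    refine lt_of_pow_lt_pow_left₀ 6 ht₀ ?_
    rwa [mul_pow, ← pow_mul, ← pow_mul, mul_comm (k - 1), mul_comm k]
  have hn₁ : 1 ≤ |(n : ℝ)| := by exact_mod_cast Int.one_le_abs hn
  have htn : 4 * |(n : ℝ)| < t := by
    refine lt_of_le_of_lt ?_ ht
    gcongr
    · exact le_self_pow₀ (by norm_num) (by omega)
    · exact le_self_pow₀ hn₁ (by omega)
  have ht₁ : 1 ≤ t := by linarith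
  have ht5 : t ^ 5 < (a₁ : ℝ) * b₁ := by
    calc t ^ 5 = t ^ 2 * t ^ 3 := by ring
      _ < (a₁ : ℝ) * b₁ := by gcongr
  have htle : t ≤ t ^ 5 := le_self_pow₀ ht₁ (by norm_num)
  have hgap := gap_of_shifted_products_eq_pow (k := k) (p := p) (q := q) (r := r) (s := s)
    (n := n) (a₁ := a₁) (a₂ := a₂) (b₁ := b₁) (b₂ := b₂) (by omega)
    (by exact_mod_cast hn) (lt_of_le_of_lt (by positivity) ha₁) (by exact_mod_cast ha)
    (lt_of_le_of_lt (by positivity) hb₁) (by exact_mod_cast hb) (by linarith)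
    (by exact_mod_cast hp) (by exact_mod_cast hq) (by exact_mod_cast hr) (by exact_mod_cast hs)
  have hupper : 4 ^ (k - 1) * |(n : ℝ)| ^ k * (a₂ * b₂) ≤ t ^ 10 := by
    calc 4 ^ (k - 1) * |(n : ℝ)| ^ k * (a₂ * b₂) ≤ t * (t ^ 3 * t ^ 6) := by gcongr
      _ = t ^ 10 := by ring
  have hlower : t ^ 10 < ((a₁ : ℝ) * b₁) ^ (k - 1) := by
    calc t ^ 10 = (t ^ 5) ^ 2 := by ring
      _ < ((a₁ : ℝ) * b₁) ^ 2 := by gcongr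
      _ ≤ ((a₁ : ℝ) * b₁) ^ (k - 1) := by
        gcongr
        · linarith
        · omega
  linarith
end

section
/- Let k ≥ 3 be an integer, let n be a nonzero integer, and let a₁ < a₂ be positive integers. Then for all sufficiently large X, the number of positive integers b ≤ X such that both a₁·b + n and a₂·b + n are k-th powers of positive integers is at most 2·log log X. -/
/-- Distinct `k`-th powers of natural numbers are far apart. -/
theorem pow_pred_le_abs_pow_sub_pow_s5 {A B : ℕ} (h : A ≠ B) {k : ℕ} (hk : k ≠ 0) :
    (A : ℤ) ^ (k - 1) ≤ |(A : ℤ) ^ k - (B : ℤ) ^ k| := by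
  obtain ⟨j, rfl⟩ := Nat.exists_eq_succ_of_ne_zero hk
  have key : ∀ U V : ℕ, U < V → (U : ℤ) ^ (j + 1) + (V : ℤ) ^ j ≤ (V : ℤ) ^ (j + 1) := by
    intro U V hUV
    have h1 : (U : ℤ) ^ j ≤ (V : ℤ) ^ j := by gcongr
    have h2 : (U : ℤ) + 1 ≤ V := by exact_mod_cast hUV
    calc (U : ℤ) ^ (j + 1) + (V : ℤ) ^ j ≤ (V : ℤ) ^ j * U + (V : ℤ) ^ j := by
          rw [pow_succ]; gcongr
      _ = (V : ℤ) ^ j * (U + 1) := by ring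
      _ ≤ (V : ℤ) ^ j * V := by gcongr
      _ = (V : ℤ) ^ (j + 1) := by ring
  simp only [Nat.succ_eq_add_one, Nat.add_sub_cancel]
  rcases lt_or_gt_of_ne h with h | h
  · have h1 : (A : ℤ) ^ j ≤ (B : ℤ) ^ j := by gcongr
    rw [abs_sub_comm]
    exact le_trans (by linarith [key A B h]) (le_abs_self _)
  · exact le_trans (by linarith [key B A h]) (le_abs_self _)

/-- Gap principle: large `b` for which `a₁ b + n` and `a₂ b + n` are both `k`-th powers
grow at least quadratically. -/
theorem sq_le_mul_of_common_shifted_powers {k : ℕ} {n : ℤ} (hk : 3 ≤ k) (hn : n ≠ 0)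
    {a₁ a₂ : ℕ} (ha₁ : 0 < a₁) (ha : a₁ < a₂) {b c x₁ x₂ y₁ y₂ : ℕ}
    (hb : 2 * |n| < b) (hbc : b < c)
    (hx₁ : (a₁ * b : ℤ) + n = (x₁ : ℤ) ^ k) (hy₁ : (a₂ * b : ℤ) + n = (y₁ : ℤ) ^ k)
    (hx₂ : (a₁ * c : ℤ) + n = (x₂ : ℤ) ^ k) (hy₂ : (a₂ * c : ℤ) + n = (y₂ : ℤ) ^ k) :
    (b : ℤ) ^ 2 ≤ 4 ^ (k - 1) * (|n| * (a₂ - a₁)) ^ k * c := by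
  have ha' : (0 : ℤ) < a₂ - a₁ := by
    have : (a₁ : ℤ) < a₂ := by exact_mod_cast ha
    linarith
  have hbc' : (0 : ℤ) < c - b := by
    have : (b : ℤ) < c := by exact_mod_cast hbc
    linarith
  have hn' : 0 < |n| := abs_pos.mpr hn
  have hb0 : (0 : ℤ) < b := by linarith
  have hc0 : (0 : ℤ) < c := by linarith
  have hdiff : ((x₁ * y₂ : ℕ) : ℤ) ^ k - ((x₂ * y₁ : ℕ) : ℤ) ^ k
      = n * ((a₂ - a₁) * (b - c)) * (-1) := by
    push_cast
    rw [mul_pow, mul_pow, ← hx₁, ← hx₂, ← hy₁, ← hy₂]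
    ring
  have hne : x₁ * y₂ ≠ x₂ * y₁ := by
    intro h
    rw [h, sub_self] at hdiff
    have : n * ((a₂ - a₁) * (b - c)) * (-1) ≠ 0 :=
      mul_ne_zero (mul_ne_zero hn (mul_ne_zero ha'.ne' (by linarith))) (by norm_num)
    exact this hdiff.symm
  have hupper : ((x₁ * y₂ : ℕ) : ℤ) ^ (k - 1) ≤ |n| * (a₂ - a₁) * c := by
    refine (pow_pred_le_abs_pow_sub_pow_s5 hne (by omega)).trans ?_
    rw [hdiff, abs_mul, abs_mul, abs_mul, abs_of_pos ha', abs_sub_comm, abs_of_pos hbc']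
    have : |n| * (a₂ - a₁) * ((c : ℤ) - b) ≤ |n| * (a₂ - a₁) * c := by
      gcongr; linarith
    simpa [mul_assoc] using this
  have half : ∀ a d : ℕ, 0 < a → 2 * |n| < (d : ℤ) → (d : ℤ) ≤ 2 * (a * d + n) := by
    intro a d h0 hd
    have h1 : (1 : ℤ) ≤ a := by exact_mod_cast h0
    have h2 : (d : ℤ) ≤ a * d := le_mul_of_one_le_left (by positivity) h1
    linarith [neg_abs_le n]
  have hlower : (b : ℤ) * c ≤ 4 * ((x₁ * y₂ : ℕ) : ℤ) ^ k := by
    have h1 := half a₁ b ha₁ hb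
    have h2 := half a₂ c (ha₁.trans ha) (by linarith)
    calc (b : ℤ) * c ≤ (2 * (a₁ * b + n)) * (2 * (a₂ * c + n)) :=
          mul_le_mul h1 h2 hc0.le (hb0.le.trans h1)
      _ = 4 * ((x₁ * y₂ : ℕ) : ℤ) ^ k := by
          push_cast
          rw [mul_pow, ← hx₁, ← hy₂]; ring
  have hmain : (b : ℤ) ^ (k - 1) * (c : ℤ) ^ (k - 1)
      ≤ 4 ^ (k - 1) * (|n| * (a₂ - a₁)) ^ k * c * (c : ℤ) ^ (k - 1) :=
    calc (b : ℤ) ^ (k - 1) * (c : ℤ) ^ (k - 1) = (b * c : ℤ) ^ (k - 1) := (mul_pow _ _ _).symm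
      _ ≤ (4 * ((x₁ * y₂ : ℕ) : ℤ) ^ k) ^ (k - 1) := by gcongr
      _ = 4 ^ (k - 1) * (((x₁ * y₂ : ℕ) : ℤ) ^ (k - 1)) ^ k := by
          rw [mul_pow, ← pow_mul, ← pow_mul, mul_comm k]
      _ ≤ 4 ^ (k - 1) * (|n| * (a₂ - a₁) * c) ^ k := by gcongr
      _ = 4 ^ (k - 1) * (|n| * (a₂ - a₁)) ^ k * c * (c : ℤ) ^ (k - 1) := by
          rw [mul_pow _ (c : ℤ), ← mul_pow_sub_one (by omega : k ≠ 0) (c : ℤ)]; ring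
  calc (b : ℤ) ^ 2 ≤ (b : ℤ) ^ (k - 1) := pow_le_pow_right₀ (by linarith) (by omega)
    _ ≤ _ := le_of_mul_le_mul_right hmain (by positivity)

/-- A finite set of natural numbers satisfying a quadratic gap condition has an element that is
doubly exponentially large in its cardinality. -/
theorem exists_mul_exp_two_pow_le {D : ℝ} (hD : 0 < D) (m : ℕ) :
    ∀ T : Finset ℕ, (∀ b ∈ T, D * Real.exp 1 ≤ b) →
      (∀ b ∈ T, ∀ c ∈ T, b < c → (b : ℝ) ^ 2 ≤ D * c) → T.card = m + 1 →
      ∃ b ∈ T, D * Real.exp (2 ^ m) ≤ b := by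
  induction m with
  | zero =>
    intro T hT _ hcard
    obtain ⟨b, hb⟩ := Finset.card_pos.mp (by omega : 0 < T.card)
    exact ⟨b, hb, by simpa using hT b hb⟩
  | succ m ih =>
    intro T hT hgap hcard
    have hne : T.Nonempty := Finset.card_pos.mp (by omega)
    have hmax := T.max'_mem hne
    obtain ⟨b, hb, hbig⟩ := ih (T.erase (T.max' hne))
      (fun b hb => hT b (Finset.mem_of_mem_erase hb))
      (fun b hb c hc => hgap b (Finset.mem_of_mem_erase hb) c (Finset.mem_of_mem_erase hc))
      (by rw [Finset.card_erase_of_mem hmax, hcard]; rfl)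
    refine ⟨T.max' hne, hmax, le_of_mul_le_mul_left ?_ hD⟩
    calc D * (D * Real.exp (2 ^ (m + 1))) = (D * Real.exp (2 ^ m)) ^ 2 := by
          rw [mul_pow, ← Real.exp_nat_mul, pow_succ (2 : ℝ) m]
          push_cast
          ring_nf
      _ ≤ (b : ℝ) ^ 2 := by gcongr
      _ ≤ _ := hgap b (Finset.mem_of_mem_erase hb) _ hmax (T.lt_max'_of_mem_erase_max' hne hb)

/-- A finite set of natural numbers up to `X` satisfying a quadratic gap condition has
at most `1 + (3 / 2) log log X` elements. -/
theorem card_le_of_quadratic_gap {D X : ℝ} (hD : 1 ≤ D) (hX : 0 ≤ Real.log (Real.log X))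
    (T : Finset ℕ) (hT : ∀ b ∈ T, D * Real.exp 1 ≤ b) (hTX : ∀ b ∈ T, (b : ℝ) ≤ X)
    (hgap : ∀ b ∈ T, ∀ c ∈ T, b < c → (b : ℝ) ^ 2 ≤ D * c) :
    (T.card : ℝ) ≤ 1 + 3 / 2 * Real.log (Real.log X) := by
  rcases Nat.eq_zero_or_eq_succ_pred T.card with h | h
  · rw [h]
    push_cast
    linarith
  · set m := T.card.pred
    obtain ⟨b, hb, hbig⟩ := exists_mul_exp_two_pow_le (by linarith) m T hT hgap h
    have h1 : Real.exp (2 ^ m) ≤ X :=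
      (le_mul_of_one_le_left (Real.exp_pos _).le hD).trans (hbig.trans (hTX b hb))
    have h2 : (2 : ℝ) ^ m ≤ Real.log X :=
      (Real.le_log_iff_exp_le ((Real.exp_pos _).trans_le h1)).mpr h1
    have h3 : (m : ℝ) * Real.log 2 ≤ Real.log (Real.log X) := by
      rw [← Real.log_pow]
      exact Real.log_le_log (by positivity) h2
    have h4 : (0 : ℝ) ≤ m := by positivity
    rw [h]
    push_cast
    nlinarith [Real.log_two_gt_d9]

/-- Corollary 2.5: for fixed `a₁ < a₂`, for all sufficiently large `X`, the number of
positive integers `b ≤ X` such that `a₁b + n` and `a₂b + n` are both `k`-th powers is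
at most `2 log log X`. -/
theorem few_common_shifted_powers (k : ℕ) (n : ℤ) (hk : 3 ≤ k) (hn : n ≠ 0)
    (a₁ a₂ : ℕ) (ha₁ : 0 < a₁) (ha : a₁ < a₂) :
    ∃ X₀ : ℝ, ∀ X : ℝ, X₀ ≤ X →
      (Set.ncard {b : ℕ | 0 < b ∧ (b : ℝ) ≤ X ∧
          (∃ x : ℕ, 0 < x ∧ (a₁ * b : ℤ) + n = (x : ℤ) ^ k) ∧
          (∃ x : ℕ, 0 < x ∧ (a₂ * b : ℤ) + n = (x : ℤ) ^ k)} : ℝ)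
        ≤ 2 * Real.log (Real.log X) := by
  set C : ℤ := 4 ^ (k - 1) * (|n| * (a₂ - a₁)) ^ k
  have hC : 1 ≤ C := by
    have h1 : (0 : ℤ) < a₂ - a₁ := by
      have : (a₁ : ℤ) < a₂ := by exact_mod_cast ha
      linarith
    have h2 : 0 < |n| := abs_pos.mpr hn
    have : 0 < C := by positivity
    linarith
  have hD : (1 : ℝ) ≤ C := by exact_mod_cast hC
  obtain ⟨N, hN⟩ := exists_nat_ge (max ((C : ℝ) * Real.exp 1) ((2 * |n| : ℤ) : ℝ))
  have hlog : ∀ᶠ X : ℝ in Filter.atTop, 2 * ((N : ℝ) + 2) ≤ Real.log (Real.log X) :=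
    (Real.tendsto_log_atTop.comp Real.tendsto_log_atTop).eventually_ge_atTop _
  obtain ⟨X₀, hX₀⟩ := Filter.eventually_atTop.mp hlog
  refine ⟨X₀, fun X hX => ?_⟩
  have hL := hX₀ X hX
  set S := {b : ℕ | 0 < b ∧ (b : ℝ) ≤ X ∧
          (∃ x : ℕ, 0 < x ∧ (a₁ * b : ℤ) + n = (x : ℤ) ^ k) ∧
          (∃ x : ℕ, 0 < x ∧ (a₂ * b : ℤ) + n = (x : ℤ) ^ k)}
  have hfin : S.Finite :=
    (Set.finite_Iic ⌊X⌋₊).subset fun b hb => Nat.le_floor hb.2.1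
  have hT : ((hfin.toFinset.filter (N < ·)).card : ℝ)
      ≤ 1 + 3 / 2 * Real.log (Real.log X) := by
    refine card_le_of_quadratic_gap hD (le_trans (by positivity) hL) _ ?_ ?_ ?_
    · intro b hb
      have h1 : (N : ℝ) < b := by exact_mod_cast (Finset.mem_filter.mp hb).2
      exact ((le_max_left _ _).trans hN).trans h1.le
    · intro b hb
      exact (hfin.mem_toFinset.mp (Finset.mem_filter.mp hb).1).2.1
    · intro b hb c hc hbc
      obtain ⟨hbS, hNb⟩ := Finset.mem_filter.mp hb
      obtain ⟨-, -, ⟨x₁, -, hx₁⟩, ⟨y₁, -, hy₁⟩⟩ := hfin.mem_toFinset.mp hbS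
      obtain ⟨-, -, ⟨x₂, -, hx₂⟩, ⟨y₂, -, hy₂⟩⟩ :=
        hfin.mem_toFinset.mp (Finset.mem_filter.mp hc).1
      have h1 : 2 * |n| ≤ (N : ℤ) := by exact_mod_cast (le_max_right _ _).trans hN
      have h2 : 2 * |n| < (b : ℤ) := h1.trans_lt (by exact_mod_cast hNb)
      have h3 : (b : ℤ) ^ 2 ≤ C * c :=
        sq_le_mul_of_common_shifted_powers hk hn ha₁ ha h2 hbc hx₁ hy₁ hx₂ hy₂
      exact_mod_cast h3
  have hsmall : (hfin.toFinset.filter (¬ N < ·)).card ≤ N + 1 := by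
    rw [← Finset.card_range (N + 1)]
    refine Finset.card_le_card fun b hb => ?_
    have := (Finset.mem_filter.mp hb).2
    exact Finset.mem_range.mpr (by omega)
  have hsmall' : ((hfin.toFinset.filter (¬ N < ·)).card : ℝ) ≤ N + 1 := by
    exact_mod_cast hsmall
  rw [Set.ncard_eq_toFinset_card S hfin,
    ← Finset.card_filter_add_card_filter_not (s := hfin.toFinset) (N < ·)]
  push_cast
  linarith
end

section
/- Let G be a bipartite graph with vertex classes U and V such that |U| = m and |V| = n. Assume that there do not exist a set X ⊆ U of size s and a set Y ⊆ V of size t such that x and y are adjacent for all x ∈ X and y ∈ Y. Then the number of edges of G is at most (s−1)^{1/t}·(n − t + 1)·m^{1 − 1/t} + (t − 1)·m. -/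
open Finset in
/-- Ratios of binomial coefficients dominate powers of the smallest factor ratio. -/
theorem Nat.pow_sub_mul_choose_le {d n : ℕ} (t : ℕ) (hdn : d ≤ n) :
    (d + 1 - t) ^ t * n.choose t ≤ d.choose t * (n + 1 - t) ^ t := by
  have key : (d + 1 - t) ^ t * n.descFactorial t ≤ d.descFactorial t * (n + 1 - t) ^ t := by
    rw [Nat.descFactorial_eq_prod_range, Nat.descFactorial_eq_prod_range]
    calc (d + 1 - t) ^ t * ∏ i ∈ range t, (n - i)
        = ∏ i ∈ range t, (d + 1 - t) * (n - i) := by simp [prod_mul_distrib]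
      _ ≤ ∏ i ∈ range t, (d - i) * (n + 1 - t) := by
          refine prod_le_prod' fun i hi => ?_
          have hit := mem_range.mp hi
          rcases Nat.lt_or_ge d t with h | h
          · simp [Nat.sub_eq_zero_of_le (Nat.succ_le_of_lt h)]
          · obtain ⟨j, rfl⟩ : ∃ j, t = i + j + 1 := ⟨t - i - 1, by omega⟩
            obtain ⟨e, rfl⟩ : ∃ e, d = e + i + j := ⟨d - i - j, by omega⟩
            obtain ⟨k, rfl⟩ : ∃ k, n = e + k + i + j := ⟨n - e - i - j, by omega⟩
            rw [show e + i + j + 1 - (i + j + 1) = e by omega,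
              show e + k + i + j - i = e + k + j by omega,
              show e + i + j - i = e + j by omega,
              show e + k + i + j + 1 - (i + j + 1) = e + k by omega]
            nlinarith [Nat.zero_le (j * k)]
      _ = (∏ i ∈ range t, (d - i)) * (n + 1 - t) ^ t := by simp [prod_mul_distrib]
  rw [Nat.descFactorial_eq_factorial_mul_choose, Nat.descFactorial_eq_factorial_mul_choose,
    mul_left_comm, mul_assoc] at key
  exact Nat.le_of_mul_le_mul_left key t.factorial_pos

open Finset Classical in
/-- Counting stars: if any `t` vertices of `V` have fewer than `s` common neighbours, there are
at most `(s - 1) * (card V).choose t` stars with centre in `U` and `t` leaves in `V`. -/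
theorem sum_choose_degree_le {U V : Type*} [Fintype U] [Fintype V] (r : U → V → Prop) {s t : ℕ}
    (hfree : ¬ ∃ (X : Finset U) (Y : Finset V), X.card = s ∧ Y.card = t ∧
      ∀ x ∈ X, ∀ y ∈ Y, r x y) :
    ∑ u, (#{v | r u v}).choose t ≤ (s - 1) * (Fintype.card V).choose t := by
  have hstar (u : U) : (#{v | r u v}).choose t =
      #((powersetCard t univ).bipartiteAbove (fun u Y => ∀ y ∈ Y, r u y) u) := by
    rw [← card_powersetCard]
    congr 1
    ext Y
    simp [bipartiteAbove, mem_powersetCard, subset_iff, and_comm]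
  rw [sum_congr rfl fun u _ => hstar u, sum_card_bipartiteAbove_eq_sum_card_bipartiteBelow]
  refine (sum_le_card_nsmul _ _ (s - 1) fun Y hY => ?_).trans_eq ?_
  · by_contra! h
    obtain ⟨X, hX, hXs⟩ := exists_subset_card_eq (Nat.le_of_pred_lt h)
    refine hfree ⟨X, Y, hXs, (mem_powersetCard.mp hY).2, fun x hx => ?_⟩
    exact (mem_bipartiteBelow _).mp (hX hx) |>.2
  · simp [card_powersetCard, mul_comm]

open Finset Classical in
theorem ncard_setOf_rel_eq_sum {U V : Type*} [Fintype U] [Fintype V] (r : U → V → Prop) :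
    Set.ncard {p : U × V | r p.1 p.2} = ∑ u, #{v | r u v} := by
  rw [Set.ncard_eq_toFinset_card', Set.toFinset_ofPred, card_filter, Fintype.sum_prod_type]
  simp only [card_filter]

open Finset in
/-- The power mean inequality, bounding a sum by the sum of `t`-th powers. -/
theorem Finset.sum_le_of_sum_pow_le {ι : Type*} (A : Finset ι) (f : ι → ℝ) {t : ℕ} {a b : ℝ}
    (ht : t ≠ 0) (hf : ∀ i ∈ A, 0 ≤ f i) (ha : 0 ≤ a) (hb : 0 ≤ b)
    (h : ∑ i ∈ A, f i ^ t ≤ a * b ^ t) :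
    ∑ i ∈ A, f i ≤ a ^ ((1 : ℝ) / t) * b * (#A : ℝ) ^ (1 - (1 : ℝ) / t) := by
  rcases A.eq_empty_or_nonempty with rfl | hA
  · simp only [sum_empty]
    positivity
  have hcard : (0 : ℝ) < #A := by exact_mod_cast hA.card_pos
  have htR : (t : ℝ) ≠ 0 := by exact_mod_cast ht
  refine le_of_pow_le_pow_left₀ ht (by positivity) ?_
  have hroot : (a ^ ((1 : ℝ) / t)) ^ t = a := by
    rw [one_div, Real.rpow_inv_natCast_pow ha ht]
  have hpow : ((#A : ℝ) ^ (1 - (1 : ℝ) / t)) ^ t = (#A : ℝ) ^ (t - 1) := by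
    rw [← Real.rpow_mul_natCast hcard.le, sub_mul, one_div_mul_cancel htR, one_mul,
      ← Real.rpow_natCast, Nat.cast_pred (Nat.pos_of_ne_zero ht)]
  obtain ⟨k, rfl⟩ := Nat.exists_eq_succ_of_ne_zero ht
  rw [mul_pow, mul_pow, hroot, hpow]
  have hmean := pow_sum_div_card_le_sum_pow (s := A) (f := f) hf k
  exact (div_le_iff₀ (by positivity)).mp (hmean.trans h)


/-- Lemma 1.4 (Kővári–Sós–Turán): a bipartite graph with parts of sizes `m` and `n`
containing no complete bipartite subgraph with `s` vertices in the first part and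
`t` in the second has at most `(s-1)^{1/t}(n-t+1)m^{1-1/t} + (t-1)m` edges. -/
theorem kovari_sos_turan {U V : Type*} [Fintype U] [Fintype V]
    (r : U → V → Prop) (m n s t : ℕ)
    (hm : Fintype.card U = m) (hn : Fintype.card V = n)
    (hs : 1 ≤ s) (ht : 1 ≤ t) (hsm : s ≤ m) (htn : t ≤ n)
    (hfree : ¬ ∃ (X : Finset U) (Y : Finset V), X.card = s ∧ Y.card = t ∧
      ∀ x ∈ X, ∀ y ∈ Y, r x y) :
    (Set.ncard {p : U × V | r p.1 p.2} : ℝ)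
      ≤ ((s : ℝ) - 1) ^ ((1 : ℝ) / t) * ((n : ℝ) - t + 1) * (m : ℝ) ^ (1 - (1 : ℝ) / t)
        + ((t : ℝ) - 1) * m := by
  classical
  subst hm hn
  set n := Fintype.card V
  let d (u : U) : ℕ := Finset.card {v | r u v}
  have hd (u : U) : d u ≤ n := Finset.card_le_univ _
  have hpow : ∑ u, (d u + 1 - t) ^ t ≤ (s - 1) * (n + 1 - t) ^ t := by
    refine Nat.le_of_mul_le_mul_right ?_ (Nat.choose_pos htn)
    calc (∑ u, (d u + 1 - t) ^ t) * n.choose t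
        ≤ ∑ u, (d u).choose t * (n + 1 - t) ^ t := by
          rw [Finset.sum_mul]
          exact Finset.sum_le_sum fun u _ => Nat.pow_sub_mul_choose_le t (hd u)
      _ ≤ (s - 1) * n.choose t * (n + 1 - t) ^ t := by
          rw [← Finset.sum_mul]
          refine Nat.mul_le_mul_right _ ?_
          convert sum_choose_degree_le r hfree
      _ = (s - 1) * (n + 1 - t) ^ t * n.choose t := by ring
  have hs' : ((s - 1 : ℕ) : ℝ) = (s : ℝ) - 1 := by push_cast [hs]; rfl
  have hn' : ((n + 1 - t : ℕ) : ℝ) = (n : ℝ) - t + 1 := by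
    rw [Nat.cast_sub (by omega)]; push_cast; ring
  have hmean := Finset.sum_le_of_sum_pow_le Finset.univ (fun u => ((d u + 1 - t : ℕ) : ℝ))
    (a := (s - 1 : ℕ)) (b := (n + 1 - t : ℕ)) (t := t) (by omega) (fun _ _ => by positivity)
    (by positivity) (by positivity) (by exact_mod_cast hpow)
  rw [hs', hn', Finset.card_univ] at hmean
  have hedges : (Set.ncard {p : U × V | r p.1 p.2} : ℝ) = ∑ u, (d u : ℝ) := by
    rw [ncard_setOf_rel_eq_sum, Nat.cast_sum]
  have hdeg (u : U) : (d u : ℝ) ≤ ((d u + 1 - t : ℕ) : ℝ) + ((t : ℝ) - 1) := by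
    have h : d u + 1 ≤ (d u + 1 - t) + t := by omega
    have h' : (d u : ℝ) + 1 ≤ ((d u + 1 - t : ℕ) : ℝ) + t := by exact_mod_cast h
    linarith
  calc (Set.ncard {p : U × V | r p.1 p.2} : ℝ)
      ≤ ∑ u, (((d u + 1 - t : ℕ) : ℝ) + ((t : ℝ) - 1)) :=
        hedges.trans_le (Finset.sum_le_sum fun u _ => hdeg u)
    _ = ∑ u, ((d u + 1 - t : ℕ) : ℝ) + ((t : ℝ) - 1) * Fintype.card U := by
        rw [Finset.sum_add_distrib, Finset.sum_const, Finset.card_univ, nsmul_eq_mul, mul_comm]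
    _ ≤ _ := by gcongr
end

section
/- Let k ≥ 3 be an integer and let n be a nonzero integer. Let X be a real number with X ≥ 4|n|^{34}. Let A₁ be a finite set of positive integers contained in [1, X^{1/3}] and let B₃ be a finite set of positive integers contained in (X^{1/2}, X]. Then the number of pairs (a, b) ∈ A₁ × B₃ such that ab − n is a k-th power of a positive integer is at most 6^{1/3}·|A₁|·|B₃|^{2/3} + 2·|B₃|. -/
/-- Distinct `k`-th powers with `k ≥ 3` are at least `3 u ^ (2k/3)` apart. -/
theorem twentySeven_mul_pow_sq_le_sub_pow_cube {k : ℕ} (hk : 3 ≤ k) {u v : ℤ} (hu : 0 < u)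
    (huv : u < v) : 27 * (u ^ k) ^ 2 ≤ (v ^ k - u ^ k) ^ 3 := by
  have hv : 0 < v := hu.trans huv
  have step : ∀ m : ℕ, u ^ (m + 1) + (m + 1) * u ^ m ≤ v ^ (m + 1) := by
    intro m
    induction m with
    | zero => simpa using huv
    | succ m ih =>
      have hm : 0 ≤ u ^ m := by positivity
      calc u ^ (m + 1 + 1) + ((m + 1 : ℕ) + 1) * u ^ (m + 1)
          ≤ (u ^ (m + 1) + (m + 1) * u ^ m) * (u + 1) := by
            push_cast
            ring_nf
            nlinarith [mul_nonneg (Nat.cast_nonneg (α := ℤ) m) hm]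
        _ ≤ v ^ (m + 1) * v := mul_le_mul ih huv (by positivity) (by positivity)
        _ = v ^ (m + 1 + 1) := by ring
  obtain ⟨m, rfl⟩ : ∃ m, k = m + 2 + 1 := ⟨k - 3, by lia⟩
  have h := step (m + 2)
  have hpos : 0 < u ^ (m + 2) := by positivity
  have hlow : 3 * u ^ (m + 2) ≤ v ^ (m + 2 + 1) - u ^ (m + 2 + 1) := by
    push_cast at h
    nlinarith [mul_nonneg (Nat.cast_nonneg (α := ℤ) m) hpos.le]
  calc 27 * (u ^ (m + 2 + 1)) ^ 2 = 27 * u ^ (2 * m + 6) := by ring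
    _ ≤ 27 * u ^ (3 * m + 6) := by
      gcongr
      all_goals lia
    _ = (3 * u ^ (m + 2)) ^ 3 := by ring
    _ ≤ _ := by gcongr

/-- Gap principle: two columns `b < b'` sharing two neighbours `a < a'` are far apart. -/
theorem gap_of_mul_sub_eq_pow {k : ℕ} (hk : 3 ≤ k) {n a a' b b' x y z w : ℤ} (hn : n ≠ 0)
    (ha : 0 < a) (haa : a < a') (hb : 2 * |n| ≤ b) (hbb : b < b')
    (hx : 0 < x) (hy : 0 < y) (hz : 0 < z) (hw : 0 < w)
    (hxe : a * b - n = x ^ k) (hye : a * b' - n = y ^ k)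
    (hze : a' * b - n = z ^ k) (hwe : a' * b' - n = w ^ k) :
    27 * b ^ 2 ≤ 16 * |n| ^ 3 * (a' * b') := by
  have hnpos : 0 < |n| := abs_pos.mpr hn
  have hbpos : 0 < b := by lia
  have ha' : 0 < a' := ha.trans haa
  have hb' : 0 < b' := hbpos.trans hbb
  have half : ∀ c d : ℤ, 0 < c → b ≤ d → c * d ≤ 2 * (c * d - n) := by
    intro c d hc hd
    nlinarith [le_abs_self n]
  have hdiff : (x * w) ^ k - (y * z) ^ k = -(n * ((a' - a) * (b' - b))) := by
    rw [mul_pow, mul_pow, ← hxe, ← hye, ← hze, ← hwe]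
    ring
  have hD : |n * ((a' - a) * (b' - b))| ≤ |n| * (a' * b') := by
    rw [abs_mul, abs_of_nonneg (mul_nonneg (by lia) (by lia) : 0 ≤ (a' - a) * (b' - b))]
    gcongr <;> lia
  have hne : (x * w) ≠ (y * z) := by
    intro h
    rw [h, sub_self, eq_comm, neg_eq_zero] at hdiff
    have : (a' - a) * (b' - b) ≠ 0 := mul_ne_zero (by lia) (by lia)
    exact mul_ne_zero hn this hdiff
  have hxw : a * b * (a' * b') ≤ 4 * (x * w) ^ k := by
    have := mul_le_mul (half a b ha le_rfl) (half a' b' ha' hbb.le) (by positivity)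
      (by rw [hxe]; positivity)
    rw [hxe, hwe] at this
    rw [mul_pow]
    linarith
  have hyz : a * b * (a' * b') ≤ 4 * (y * z) ^ k := by
    have := mul_le_mul (half a b' ha hbb.le) (half a' b ha' le_rfl) (by positivity)
      (by rw [hye]; positivity)
    rw [hye, hze] at this
    rw [mul_pow]
    linarith
  obtain ⟨M, hM, hMD⟩ : ∃ M : ℤ, a * b * (a' * b') ≤ 4 * M ∧
      27 * M ^ 2 ≤ (|n| * (a' * b')) ^ 3 := by
    rcases lt_or_gt_of_ne hne with h | h
    · refine ⟨_, hxw, (twentySeven_mul_pow_sq_le_sub_pow_cube hk (by positivity) h).trans ?_⟩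
      have h0 : (x * w) ^ k ≤ (y * z) ^ k := by gcongr
      refine pow_le_pow_left₀ (by lia) (le_trans ?_ hD) 3
      exact (by lia : (y * z) ^ k - (x * w) ^ k = n * ((a' - a) * (b' - b))).trans_le
        (le_abs_self _)
    · refine ⟨_, hyz, (twentySeven_mul_pow_sq_le_sub_pow_cube hk (by positivity) h).trans ?_⟩
      have h0 : (y * z) ^ k ≤ (x * w) ^ k := by gcongr
      refine pow_le_pow_left₀ (by lia) (le_trans ?_ hD) 3
      exact hdiff.trans_le (neg_le_abs _)
  have hbM : b * (a' * b') ≤ 4 * M := by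
    refine le_trans ?_ hM
    have : 0 < b * (a' * b') := by positivity
    nlinarith
  have hsq : (b * (a' * b')) ^ 2 ≤ (4 * M) ^ 2 := pow_le_pow_left₀ (by positivity) hbM 2
  have hpos : 0 < (a' * b') ^ 2 := by positivity
  refine le_of_mul_le_mul_right ?_ hpos
  calc 27 * b ^ 2 * (a' * b') ^ 2 = 27 * (b * (a' * b')) ^ 2 := by ring
    _ ≤ 27 * (4 * M) ^ 2 := by gcongr
    _ = 16 * (27 * M ^ 2) := by ring
    _ ≤ 16 * (|n| * (a' * b')) ^ 3 := by gcongr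
    _ = _ := by ring

/-- Kővári–Sós–Turán double counting: if any two distinct elements of `A` have at most `t` common
neighbours in `B`, the number `E` of incidences satisfies `E ^ 2 ≤ #B * (E + t * #A ^ 2)`. -/
theorem sq_card_incidences_le {α β : Type*} [DecidableEq α] (A : Finset α) (B : Finset β)
    (r : α → β → Prop) [∀ a b, Decidable (r a b)] (t : ℕ)
    (h : ∀ a ∈ A, ∀ a' ∈ A, a ≠ a' → (B.filter fun b => r a b ∧ r a' b).card ≤ t) :
    ((A ×ˢ B).filter fun p => r p.1 p.2).card ^ 2 ≤
      B.card * (((A ×ˢ B).filter fun p => r p.1 p.2).card + t * A.card ^ 2) := by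
  have hE : ((A ×ˢ B).filter fun p => r p.1 p.2).card =
      ∑ a ∈ A, (B.filter fun b => r a b).card := by
    simp only [Finset.card_filter, Finset.sum_product]
  have hE' : ((A ×ˢ B).filter fun p => r p.1 p.2).card =
      ∑ b ∈ B, (A.filter fun a => r a b).card := by
    simp only [Finset.card_filter, Finset.sum_product_right]
  have hsq : ∑ b ∈ B, (A.filter fun a => r a b).card ^ 2 =
      ∑ a ∈ A, ∑ a' ∈ A, (B.filter fun b => r a b ∧ r a' b).card := by
    simp only [Finset.card_filter, sq, Finset.sum_mul_sum]
    rw [Finset.sum_comm]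
    refine Finset.sum_congr rfl fun a _ => ?_
    rw [Finset.sum_comm]
    refine Finset.sum_congr rfl fun a' _ => Finset.sum_congr rfl fun b _ => ?_
    by_cases h₁ : r a b <;> by_cases h₂ : r a' b <;> simp [h₁, h₂]
  have hrow : ∀ a ∈ A, ∑ a' ∈ A, (B.filter fun b => r a b ∧ r a' b).card ≤
      (B.filter fun b => r a b).card + t * A.card := by
    intro a ha
    calc ∑ a' ∈ A, (B.filter fun b => r a b ∧ r a' b).card
        ≤ ∑ a' ∈ A, ((if a = a' then (B.filter fun b => r a b).card else 0) + t) := by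
          refine Finset.sum_le_sum fun a' ha' => ?_
          split_ifs with haa
          · subst haa
            simp
          · simpa using h a ha a' ha' haa
      _ = _ := by simp [Finset.sum_add_distrib, ha, mul_comm]
  calc ((A ×ˢ B).filter fun p => r p.1 p.2).card ^ 2
      ≤ B.card * ∑ b ∈ B, (A.filter fun a => r a b).card ^ 2 := by
        rw [hE']
        exact sq_sum_le_card_mul_sum_sq
    _ ≤ B.card * ∑ a ∈ A, ((B.filter fun b => r a b).card + t * A.card) := by
        rw [hsq]
        exact Nat.mul_le_mul_left _ (Finset.sum_le_sum hrow)
    _ = _ := by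
        rw [hE, Finset.sum_add_distrib]
        simp only [Finset.sum_const, smul_eq_mul]
        ring

/-- A four-term sequence in `(Y ^ (3 / 2), Y ^ 3]` cannot satisfy the gap principle throughout. -/
theorem false_of_four_gaps {N Y b₁ b₂ b₃ b₄ : ℝ} (hN : 1 ≤ N) (hY : 0 < Y)
    (hNY : 4 * N ^ 34 ≤ Y ^ 3) (hb₁ : Y ^ 3 < b₁ ^ 2) (hb₄ : b₄ ≤ Y ^ 3)
    (h₁₂ : b₁ ^ 2 ≤ N ^ 3 * Y * b₂) (h₂₃ : b₂ ^ 2 ≤ N ^ 3 * Y * b₃)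
    (h₃₄ : b₃ ^ 2 ≤ N ^ 3 * Y * b₄) : False := by
  have hN0 : 0 < N := by linarith
  have e₂ : Y ^ 2 ≤ N ^ 3 * b₂ := by
    refine le_of_mul_le_mul_left ?_ hY
    linarith
  have e₃ : Y ^ 3 ≤ N ^ 9 * b₃ := by
    refine le_of_mul_le_mul_left ?_ hY
    calc Y * Y ^ 3 = (Y ^ 2) ^ 2 := by ring
      _ ≤ (N ^ 3 * b₂) ^ 2 := by gcongr
      _ = N ^ 6 * b₂ ^ 2 := by ring
      _ ≤ N ^ 6 * (N ^ 3 * Y * b₃) := by gcongr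
      _ = _ := by ring
  have e₄ : Y ^ 2 ≤ N ^ 21 := by
    refine le_of_mul_le_mul_left ?_ (by positivity : 0 < Y ^ 4)
    calc Y ^ 4 * Y ^ 2 = (Y ^ 3) ^ 2 := by ring
      _ ≤ (N ^ 9 * b₃) ^ 2 := by gcongr
      _ = N ^ 18 * b₃ ^ 2 := by ring
      _ ≤ N ^ 18 * (N ^ 3 * Y * b₄) := by gcongr
      _ ≤ N ^ 18 * (N ^ 3 * Y * Y ^ 3) := by gcongr
      _ = _ := by ring
  have h₁ : (4 * N ^ 34) ^ 2 ≤ N ^ 63 := by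
    calc (4 * N ^ 34) ^ 2 ≤ (Y ^ 3) ^ 2 := by gcongr
      _ = (Y ^ 2) ^ 3 := by ring
      _ ≤ (N ^ 21) ^ 3 := by gcongr
      _ = _ := by ring
  have h₂ : N ^ 63 ≤ N ^ 68 := pow_le_pow_right₀ hN (by norm_num)
  have h₃ : 0 < N ^ 68 := by positivity
  nlinarith

/-- Two distinct elements `a < a'` of `[1, Y]` have at most three common neighbours in
`(Y ^ (3 / 2), Y ^ 3]`. -/
theorem card_common_neighbours_le_three {k : ℕ} (hk : 3 ≤ k) {n : ℤ} (hn : n ≠ 0) {Y : ℝ}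
    (hY : 0 < Y) (hNY : 4 * |(n : ℝ)| ^ 34 ≤ Y ^ 3) {a a' : ℕ} (ha : 0 < a) (haa : a < a')
    (haY : (a' : ℝ) ≤ Y) (S : Finset ℕ)
    (hS : ∀ b ∈ S, Y ^ 3 < (b : ℝ) ^ 2 ∧ (b : ℝ) ≤ Y ^ 3)
    (hr : ∀ b ∈ S, (∃ x : ℕ, 0 < x ∧ (a * b : ℤ) - n = (x : ℤ) ^ k) ∧
      ∃ x : ℕ, 0 < x ∧ (a' * b : ℤ) - n = (x : ℤ) ^ k) : S.card ≤ 3 := by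
  by_contra! hcard
  obtain ⟨T, hTS, hT⟩ := Finset.exists_subset_card_eq (show 4 ≤ S.card from hcard)
  have hN1 : (1 : ℝ) ≤ |(n : ℝ)| := by exact_mod_cast Int.one_le_abs hn
  have hb0 : ∀ b ∈ S, (0 : ℝ) < b := by
    intro b hb
    have h : (b : ℝ) ≠ 0 := by
      intro h0
      have := (hS b hb).1
      rw [h0] at this
      linarith [pow_pos hY 3]
    exact lt_of_le_of_ne b.cast_nonneg h.symm
  have hbn : ∀ b ∈ S, 2 * |n| ≤ (b : ℤ) := by
    intro b hb
    have h : (2 * |(n : ℝ)|) ^ 2 ≤ (b : ℝ) ^ 2 := by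
      have : |(n : ℝ)| ^ 2 ≤ |(n : ℝ)| ^ 34 := pow_le_pow_right₀ hN1 (by norm_num)
      linarith [(hS b hb).1]
    have := (sq_le_sq₀ (by positivity) (hb0 b hb).le).mp h
    exact_mod_cast this
  have gap : ∀ b ∈ S, ∀ b' ∈ S, b < b' → (b : ℝ) ^ 2 ≤ |(n : ℝ)| ^ 3 * Y * b' := by
    intro b hb b' hb' hbb
    obtain ⟨⟨x, hx, hxe⟩, z, hz, hze⟩ := hr b hb
    obtain ⟨⟨y, hy, hye⟩, w, hw, hwe⟩ := hr b' hb'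
    have h := gap_of_mul_sub_eq_pow hk hn (by exact_mod_cast ha) (by exact_mod_cast haa)
      (hbn b hb) (by exact_mod_cast hbb) (by exact_mod_cast hx) (by exact_mod_cast hy)
      (by exact_mod_cast hz) (by exact_mod_cast hw) hxe hye hze hwe
    have h' : 27 * (b : ℝ) ^ 2 ≤ 16 * |(n : ℝ)| ^ 3 * (a' * b') := by exact_mod_cast h
    have h'' : |(n : ℝ)| ^ 3 * a' * b' ≤ |(n : ℝ)| ^ 3 * Y * b' := by gcongr
    nlinarith [sq_nonneg (b : ℝ)]
  let f := T.orderEmbOfFin hT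
  have hf : ∀ i, f i ∈ S := fun i => hTS (T.orderEmbOfFin_mem hT i)
  have hlt : ∀ i j, i < j → f i < f j := fun i j hij => f.strictMono hij
  exact false_of_four_gaps hN1 hY hNY (hS _ (hf 0)).1 (hS _ (hf 3)).2
    (gap _ (hf 0) _ (hf 1) (hlt 0 1 (by decide)))
    (gap _ (hf 1) _ (hf 2) (hlt 1 2 (by decide))) (gap _ (hf 2) _ (hf 3) (hlt 2 3 (by decide)))

/-- Step (2) in the proof of Claim 3.1: for `A₁ ⊆ [1, X^{1/3}]` and
`B₃ ⊆ (X^{1/2}, X]` with `X ≥ 4|n|^34`, the number of pairs `(a, b) ∈ A₁ × B₃` with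
`ab − n` a `k`-th power is at most `6^{1/3}|A₁||B₃|^{2/3} + 2|B₃|`. -/
theorem pairs_bound_A1_B3 (k : ℕ) (n : ℤ) (hk : 3 ≤ k) (hn : n ≠ 0)
    (X : ℝ) (hX : 4 * |(n : ℝ)| ^ 34 ≤ X)
    (A₁ B₃ : Finset ℕ)
    (hA₁ : ∀ a ∈ A₁, 0 < a ∧ (a : ℝ) ≤ X ^ ((1 : ℝ) / 3))
    (hB₃ : ∀ b ∈ B₃, X ^ ((1 : ℝ) / 2) < (b : ℝ) ∧ (b : ℝ) ≤ X) :
    (Set.ncard {p : ℕ × ℕ | p.1 ∈ A₁ ∧ p.2 ∈ B₃ ∧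
        ∃ x : ℕ, 0 < x ∧ (p.1 * p.2 : ℤ) - n = (x : ℤ) ^ k} : ℝ)
      ≤ (6 : ℝ) ^ ((1 : ℝ) / 3) * (A₁.card : ℝ) * (B₃.card : ℝ) ^ ((2 : ℝ) / 3)
        + 2 * (B₃.card : ℝ) := by
  classical
  have hN1 : (1 : ℝ) ≤ |(n : ℝ)| := by exact_mod_cast Int.one_le_abs hn
  have hX0 : 0 < X := lt_of_lt_of_le (by positivity) hX
  set Y := X ^ ((1 : ℝ) / 3) with hYdef
  have hY : 0 < Y := by positivity
  have hY3 : Y ^ 3 = X := by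
    rw [hYdef, ← Real.rpow_natCast, ← Real.rpow_mul hX0.le]
    norm_num
  have hsqrt : (X ^ ((1 : ℝ) / 2)) ^ 2 = X := by
    rw [← Real.rpow_natCast, ← Real.rpow_mul hX0.le]
    norm_num
  let r : ℕ → ℕ → Prop := fun a b => ∃ x : ℕ, 0 < x ∧ (a * b : ℤ) - n = (x : ℤ) ^ k
  have hset : {p : ℕ × ℕ | p.1 ∈ A₁ ∧ p.2 ∈ B₃ ∧
      ∃ x : ℕ, 0 < x ∧ (p.1 * p.2 : ℤ) - n = (x : ℤ) ^ k} =
      ((A₁ ×ˢ B₃).filter fun p => r p.1 p.2 : Finset (ℕ × ℕ)) := by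
    ext p
    simp [r, and_assoc]
  rw [hset, Set.ncard_coe_finset]
  have hlt : ∀ a ∈ A₁, ∀ a' ∈ A₁, a < a' →
      (B₃.filter fun b => r a b ∧ r a' b).card ≤ 3 := by
    intro a ha a' ha' haa
    refine card_common_neighbours_le_three hk hn hY (hX.trans_eq hY3.symm) (hA₁ a ha).1 haa
      (hA₁ a' ha').2 _ (fun b hb => ?_) (fun b hb => (Finset.mem_filter.mp hb).2)
    obtain ⟨h₁, h₂⟩ := hB₃ b (Finset.mem_filter.mp hb).1
    refine ⟨?_, h₂.trans_eq hY3.symm⟩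
    rw [hY3]
    calc X = (X ^ ((1 : ℝ) / 2)) ^ 2 := hsqrt.symm
      _ < (b : ℝ) ^ 2 := by gcongr
  have hE := sq_card_incidences_le A₁ B₃ r 3 (by
    intro a ha a' ha' hne
    rcases lt_or_gt_of_ne hne with h | h
    · exact hlt a ha a' ha' h
    · simpa only [and_comm] using hlt a' ha' a ha h)
  set E := ((A₁ ×ˢ B₃).filter fun p => r p.1 p.2).card
  have hER : (E : ℝ) ^ 2 ≤ B₃.card * (E + 3 * (A₁.card : ℝ) ^ 2) := by exact_mod_cast hE
  set T := (6 : ℝ) ^ ((1 : ℝ) / 3) * (A₁.card : ℝ) * (B₃.card : ℝ) ^ ((2 : ℝ) / 3) with hT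
  have hT0 : 0 ≤ T := by positivity
  have hT3 : T ^ 3 = 6 * (A₁.card : ℝ) ^ 3 * (B₃.card : ℝ) ^ 2 := by
    have h6 : ((6 : ℝ) ^ ((1 : ℝ) / 3)) ^ 3 = 6 := by
      rw [← Real.rpow_natCast, ← Real.rpow_mul (by norm_num)]
      norm_num
    have hB : ((B₃.card : ℝ) ^ ((2 : ℝ) / 3)) ^ 3 = (B₃.card : ℝ) ^ 2 := by
      rw [← Real.rpow_natCast, ← Real.rpow_mul (by positivity)]
      norm_num
    rw [hT, mul_pow, mul_pow, h6, hB]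
  have hB34 : (B₃.card : ℝ) ^ 3 ≤ (B₃.card : ℝ) ^ 4 := by
    rcases Nat.eq_zero_or_pos B₃.card with h | h
    · simp [h]
    · exact pow_le_pow_right₀ (by exact_mod_cast h) (by norm_num)
  have hT2 : 3 * (A₁.card : ℝ) ^ 2 * B₃.card ≤ T ^ 2 := by
    refine (pow_le_pow_iff_left₀ (by positivity) (by positivity) (by norm_num : 3 ≠ 0)).mp ?_
    calc (3 * (A₁.card : ℝ) ^ 2 * B₃.card) ^ 3
        = 27 * (A₁.card : ℝ) ^ 6 * (B₃.card : ℝ) ^ 3 := by ring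
      _ ≤ 36 * (A₁.card : ℝ) ^ 6 * (B₃.card : ℝ) ^ 4 := by gcongr; norm_num
      _ = (T ^ 3) ^ 2 := by rw [hT3]; ring
      _ = (T ^ 2) ^ 3 := by ring
  have hB0 : (0 : ℝ) ≤ B₃.card := by positivity
  by_contra! hcon
  nlinarith
end

section
/- Let k ≥ 3 be an integer and let n be a nonzero integer. Let X be a real number with X > 4^{6(k−1)}·|n|^{6k}. Let A₂ be a finite set of positive integers contained in (X^{1/3}, X^{1/2}] and let B₃ be a finite set of positive integers contained in (X^{1/2}, X]. Then the number of pairs (a, b) ∈ A₂ × B₃ such that ab − n is a k-th power of a positive integer is at most 2^{1/2}·|A₂|·|B₃|^{1/2} + |B₃|. -/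
/-- A Kővári–Sós–Turán type bound: a bipartite relation containing no `K_{2,2}` has few edges. -/
theorem Finset.sq_card_filter_product_le_of_no_rectangle {α β : Type*} [DecidableEq α]
    (r : α → β → Prop) [∀ a b, Decidable (r a b)] (s : Finset α) (t : Finset β)
    (hr : ∀ a ∈ s, ∀ a' ∈ s, ∀ b ∈ t, ∀ b' ∈ t,
      r a b → r a' b → r a b' → r a' b' → a = a' ∨ b = b') :
    ((s ×ˢ t).filter fun p => r p.1 p.2).card ^ 2 ≤
      t.card * (s.card ^ 2 + ((s ×ˢ t).filter fun p => r p.1 p.2).card) := by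
  set N : β → Finset α := fun b => s.filter fun a => r a b
  have hE : ((s ×ˢ t).filter fun p => r p.1 p.2).card = ∑ b ∈ t, (N b).card := by
    simp only [N, Finset.card_filter, Finset.sum_product_right]
  have hoff : ∑ b ∈ t, (N b).offDiag.card ≤ s.card ^ 2 := by
    classical
    rw [← Finset.card_biUnion, sq, ← Finset.card_product]
    · refine Finset.card_le_card fun p hp => ?_
      simp only [N, Finset.mem_biUnion, Finset.mem_offDiag, Finset.mem_filter] at hp
      obtain ⟨b, -, h₁, h₂, -⟩ := hp
      exact Finset.mem_product.2 ⟨h₁.1, h₂.1⟩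
    · intro b hb b' hb' hne
      rw [Function.onFun, Finset.disjoint_left]
      intro p hp hp'
      simp only [N, Finset.mem_offDiag, Finset.mem_filter] at hp hp'
      rcases hr _ hp.1.1 _ hp.2.1.1 b hb b' hb' hp.1.2 hp.2.1.2 hp'.1.2 hp'.2.1.2 with h | h
      · exact hp.2.2 h
      · exact hne h
  have hsq : ∑ b ∈ t, (N b).card ^ 2 = ∑ b ∈ t, (N b).offDiag.card + ∑ b ∈ t, (N b).card := by
    rw [← Finset.sum_add_distrib]
    refine Finset.sum_congr rfl fun b _ => ?_
    rw [Finset.offDiag_card, sq, Nat.sub_add_cancel (Nat.le_mul_self _)]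
  rw [hE]
  calc (∑ b ∈ t, (N b).card) ^ 2 ≤ t.card * ∑ b ∈ t, (N b).card ^ 2 := sq_sum_le_card_mul_sum_sq
    _ ≤ _ := by rw [hsq]; gcongr

theorem le_sqrt_two_mul_add_of_sq_le {e a b : ℝ} (ha : 0 ≤ a) (hb : 0 ≤ b)
    (h : e ^ 2 ≤ b * (a ^ 2 + e)) : e ≤ √2 * a * √b + b := by
  have hS0 : 0 ≤ √2 * a * √b := by positivity
  have hS2 : (√2 * a * √b) ^ 2 = 2 * a ^ 2 * b := by
    rw [mul_pow, mul_pow, Real.sq_sqrt zero_le_two, Real.sq_sqrt hb]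
  have hab : 0 ≤ a ^ 2 * b := by positivity
  by_contra! hlt
  nlinarith [mul_nonneg hS0 hb, mul_pos (sub_pos.2 hlt) (sub_pos.2 hlt)]

/-- Distinct `k`-th powers are far apart. -/
theorem max_pow_sub_one_le_abs_pow_sub_pow {k p q : ℕ} (hk : 1 ≤ k) (hpq : p ≠ q) :
    ((max p q : ℕ) : ℤ) ^ (k - 1) ≤ |(p : ℤ) ^ k - (q : ℤ) ^ k| := by
  obtain ⟨m, rfl⟩ := Nat.exists_eq_add_of_le' hk
  wlog h : p < q generalizing p q with H
  · rw [max_comm, abs_sub_comm]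
    exact H hpq.symm (by omega)
  have h₁ : ((p : ℤ) + 1) ≤ q := by exact_mod_cast h
  have h₂ : (p : ℤ) ^ m ≤ (q : ℤ) ^ m := by gcongr
  have h₃ : (0 : ℤ) ≤ (p : ℤ) := by positivity
  have h₄ : (0 : ℤ) ≤ (q : ℤ) ^ m := by positivity
  rw [max_eq_right h.le, abs_sub_comm, Nat.add_sub_cancel]
  refine le_trans ?_ (le_abs_self _)
  rw [pow_succ, pow_succ]
  nlinarith [mul_le_mul_of_nonneg_right h₂ h₃, mul_le_mul_of_nonneg_left h₁ h₄]

/-- A gap principle: if `ab - n`, `ab' - n`, `a'b - n` and `a'b' - n` are all `k`-th powers,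
where `a < a'` and `b < b'`, then `a'b'` is much larger than `ab`. -/
theorem mul_pow_le_of_sub_eq_pow {k a a' b b' x y z w : ℕ} {n : ℤ} (hk : 1 ≤ k) (hn : n ≠ 0)
    (hb : 0 < b) (ha' : a < a') (hb' : b < b') (hab : 2 * |n| ≤ a * b)
    (hx : (a * b : ℤ) - n = (x : ℤ) ^ k) (hy : (a * b' : ℤ) - n = (y : ℤ) ^ k)
    (hz : (a' * b : ℤ) - n = (z : ℤ) ^ k) (hw : (a' * b' : ℤ) - n = (w : ℤ) ^ k) :
    (a * b : ℤ) ^ (k - 1) ≤ 4 ^ (k - 1) * |n| ^ k * (a' * b') := by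
  have haZ : (a : ℤ) < a' := by exact_mod_cast ha'
  have hbZ : (b : ℤ) < b' := by exact_mod_cast hb'
  have ha0 : (0 : ℤ) ≤ a := by positivity
  have hb0 : (0 : ℤ) < b := by exact_mod_cast hb
  have hdiff : ((x * w : ℕ) : ℤ) ^ k - ((y * z : ℕ) : ℤ) ^ k = -(n * ((a' - a) * (b' - b))) := by
    push_cast
    rw [mul_pow, mul_pow, ← hx, ← hy, ← hz, ← hw]
    ring
  have hne : x * w ≠ y * z := by
    intro h
    rw [h, sub_self, eq_comm, neg_eq_zero] at hdiff
    exact mul_ne_zero hn (mul_ne_zero (sub_ne_zero.2 haZ.ne') (sub_ne_zero.2 hbZ.ne')) hdiff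
  set M : ℤ := ((max (x * w) (y * z) : ℕ) : ℤ)
  have hM0 : 0 ≤ M := by positivity
  have hupper : M ^ (k - 1) ≤ |n| * (a' * b') := by
    refine (max_pow_sub_one_le_abs_pow_sub_pow hk hne).trans ?_
    rw [hdiff, abs_neg, abs_mul, abs_mul, abs_of_pos (sub_pos.2 haZ), abs_of_pos (sub_pos.2 hbZ)]
    gcongr <;> linarith
  have hlower : (a * b : ℤ) * (a' * b') ≤ 4 * M ^ k := by
    have hle : ((x * w : ℕ) : ℤ) ^ k ≤ M ^ k := by
      have : ((x * w : ℕ) : ℤ) ≤ M := Int.ofNat_le.2 (le_max_left _ _)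
      gcongr
    have hn' := le_abs_self n
    have h₀ : (a * b : ℤ) ≤ a' * b' := by gcongr
    have h₁ : (a * b : ℤ) ≤ 2 * (x : ℤ) ^ k := by linarith
    have h₂ : (a' * b' : ℤ) ≤ 2 * (w : ℤ) ^ k := by linarith
    calc (a * b : ℤ) * (a' * b') ≤ (2 * (x : ℤ) ^ k) * (2 * (w : ℤ) ^ k) := by gcongr
      _ = 4 * ((x * w : ℕ) : ℤ) ^ k := by push_cast; ring
      _ ≤ _ := by linarith
  have hpos : (0 : ℤ) < (a' * b') ^ (k - 1) := by
    have : (0 : ℤ) < a' * b' := mul_pos (by linarith) (by linarith)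
    positivity
  refine le_of_mul_le_mul_right ?_ hpos
  calc (a * b : ℤ) ^ (k - 1) * (a' * b') ^ (k - 1) = ((a * b : ℤ) * (a' * b')) ^ (k - 1) :=
        (mul_pow _ _ _).symm
    _ ≤ (4 * M ^ k) ^ (k - 1) := by gcongr
    _ = 4 ^ (k - 1) * (M ^ (k - 1)) ^ k := by rw [mul_pow, pow_right_comm]
    _ ≤ 4 ^ (k - 1) * (|n| * (a' * b')) ^ k := by gcongr
    _ = 4 ^ (k - 1) * |n| ^ k * (a' * b') * (a' * b') ^ (k - 1) := by
        obtain ⟨m, rfl⟩ := Nat.exists_eq_add_of_le' hk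
        rw [Nat.add_sub_cancel]
        ring

/-- In the ranges `a, a' ∈ (Y², Y³]` and `b, b' ∈ (Y³, Y⁶]` with `Y` large, the four numbers
`ab - n`, `ab' - n`, `a'b - n`, `a'b' - n` cannot all be `k`-th powers. -/
theorem not_rectangle_of_sub_eq_pow {k a a' b b' x y z w : ℕ} {n : ℤ} {Y : ℝ} (hk : 3 ≤ k)
    (hn : n ≠ 0) (hY : 4 ^ (k - 1) * |(n : ℝ)| ^ k < Y)
    (ha : Y ^ 2 < a) (ha₂ : (a' : ℝ) ≤ Y ^ 3) (hb : Y ^ 3 < b) (hb₂ : (b' : ℝ) ≤ Y ^ 6)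
    (ha' : a < a') (hb' : b < b')
    (hx : (a * b : ℤ) - n = (x : ℤ) ^ k) (hy : (a * b' : ℤ) - n = (y : ℤ) ^ k)
    (hz : (a' * b : ℤ) - n = (z : ℤ) ^ k) (hw : (a' * b' : ℤ) - n = (w : ℤ) ^ k) : False := by
  have hn1 : (1 : ℝ) ≤ |(n : ℝ)| := by exact_mod_cast Int.one_le_abs hn
  have hnk : |(n : ℝ)| ≤ |(n : ℝ)| ^ k := le_self_pow₀ hn1 (by omega)
  have h4 : (4 : ℝ) ≤ 4 ^ (k - 1) := le_self_pow₀ (by norm_num) (by omega)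
  have hY4 : 4 * |(n : ℝ)| < Y := lt_of_le_of_lt (by gcongr) hY
  have hY1 : (1 : ℝ) ≤ Y := by linarith
  have hY5 : Y ^ 5 ≤ (a : ℝ) * b := by
    calc Y ^ 5 = Y ^ 2 * Y ^ 3 := by ring
      _ ≤ _ := by gcongr
  have hab : 2 * |n| ≤ (a : ℤ) * b := by
    have : 2 * |(n : ℝ)| ≤ (a : ℝ) * b := by
      have : Y ≤ Y ^ 5 := le_self_pow₀ hY1 (by norm_num)
      linarith
    exact_mod_cast this
  have hb0 : 0 < b := by
    have : (0 : ℝ) < b := lt_trans (by positivity) hb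
    exact_mod_cast this
  have hgap := mul_pow_le_of_sub_eq_pow (by omega) hn hb0 ha' hb' hab hx hy hz hw
  have hgapR : ((a : ℝ) * b) ^ (k - 1) ≤ 4 ^ (k - 1) * |(n : ℝ)| ^ k * (a' * b') := by
    exact_mod_cast hgap
  have : Y ^ 10 < Y ^ 10 :=
    calc Y ^ 10 = (Y ^ 5) ^ 2 := by ring
      _ ≤ (Y ^ 5) ^ (k - 1) := pow_le_pow_right₀ (one_le_pow₀ hY1) (by omega)
      _ ≤ ((a : ℝ) * b) ^ (k - 1) := by gcongr
      _ ≤ 4 ^ (k - 1) * |(n : ℝ)| ^ k * (a' * b') := hgapR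
      _ ≤ 4 ^ (k - 1) * |(n : ℝ)| ^ k * (Y ^ 3 * Y ^ 6) := by gcongr
      _ < Y * (Y ^ 3 * Y ^ 6) := by gcongr
      _ = Y ^ 10 := by ring
  exact lt_irrefl _ this


/-- Step (3) in the proof of Claim 3.1: for `A₂ ⊆ (X^{1/3}, X^{1/2}]` and
`B₃ ⊆ (X^{1/2}, X]` with `X > 4^{6(k-1)}|n|^{6k}`, the number of pairs
`(a, b) ∈ A₂ × B₃` with `ab − n` a `k`-th power is at most
`2^{1/2}|A₂||B₃|^{1/2} + |B₃|`. -/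
theorem pairs_bound_A2_B3 (k : ℕ) (n : ℤ) (hk : 3 ≤ k) (hn : n ≠ 0)
    (X : ℝ) (hX : 4 ^ (6 * (k - 1)) * |(n : ℝ)| ^ (6 * k) < X)
    (A₂ B₃ : Finset ℕ)
    (hA₂ : ∀ a ∈ A₂, X ^ ((1 : ℝ) / 3) < (a : ℝ) ∧ (a : ℝ) ≤ X ^ ((1 : ℝ) / 2))
    (hB₃ : ∀ b ∈ B₃, X ^ ((1 : ℝ) / 2) < (b : ℝ) ∧ (b : ℝ) ≤ X) :
    (Set.ncard {p : ℕ × ℕ | p.1 ∈ A₂ ∧ p.2 ∈ B₃ ∧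
        ∃ x : ℕ, 0 < x ∧ (p.1 * p.2 : ℤ) - n = (x : ℤ) ^ k} : ℝ)
      ≤ (2 : ℝ) ^ ((1 : ℝ) / 2) * (A₂.card : ℝ) * (B₃.card : ℝ) ^ ((1 : ℝ) / 2)
        + (B₃.card : ℝ) := by
  classical
  set r : ℕ → ℕ → Prop := fun a b => ∃ x : ℕ, 0 < x ∧ (a * b : ℤ) - n = (x : ℤ) ^ k with hr
  have hX0 : 0 < X := lt_of_le_of_lt (by positivity) hX
  set Y : ℝ := X ^ ((1 : ℝ) / 6) with hYdef
  have hpow : ∀ m : ℕ, Y ^ m = X ^ ((1 : ℝ) / 6 * m) := fun m => by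
    rw [hYdef, Real.rpow_mul hX0.le, Real.rpow_natCast]
  have h2 : X ^ ((1 : ℝ) / 3) = Y ^ 2 := by rw [hpow]; norm_num
  have h3 : X ^ ((1 : ℝ) / 2) = Y ^ 3 := by rw [hpow]; norm_num
  have h6 : X = Y ^ 6 := by rw [hpow]; norm_num
  have hY : 4 ^ (k - 1) * |(n : ℝ)| ^ k < Y := by
    refine lt_of_pow_lt_pow_left₀ 6 (by positivity) ?_
    rw [← h6, mul_pow, ← pow_mul, ← pow_mul, mul_comm _ 6, mul_comm k 6]
    exact hX
  have hset : {p : ℕ × ℕ | p.1 ∈ A₂ ∧ p.2 ∈ B₃ ∧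
      ∃ x : ℕ, 0 < x ∧ (p.1 * p.2 : ℤ) - n = (x : ℤ) ^ k} =
      (((A₂ ×ˢ B₃).filter fun p => r p.1 p.2 : Finset (ℕ × ℕ)) : Set (ℕ × ℕ)) := by
    ext p
    simp [hr, and_assoc]
  rw [hset, Set.ncard_coe_finset]
  have hrect := Finset.sq_card_filter_product_le_of_no_rectangle r A₂ B₃ (by
    rintro a ha a' ha' b hb b' hb' ⟨x, -, hx⟩ ⟨z, -, hz⟩ ⟨y, -, hy⟩ ⟨w, -, hw⟩
    by_contra! hne
    rw [h2, h3] at hA₂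
    rw [h3] at hB₃
    have hle : ∀ b ∈ B₃, (b : ℝ) ≤ Y ^ 6 := fun b hb => (hB₃ b hb).2.trans_eq h6
    rcases lt_or_gt_of_ne hne.1 with h | h <;> rcases lt_or_gt_of_ne hne.2 with h' | h'
    · exact not_rectangle_of_sub_eq_pow hk hn hY (hA₂ a ha).1 (hA₂ a' ha').2 (hB₃ b hb).1
        (hle b' hb') h h' hx hy hz hw
    · exact not_rectangle_of_sub_eq_pow hk hn hY (hA₂ a ha).1 (hA₂ a' ha').2 (hB₃ b' hb').1
        (hle b hb) h h' hy hx hw hz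
    · exact not_rectangle_of_sub_eq_pow hk hn hY (hA₂ a' ha').1 (hA₂ a ha).2 (hB₃ b hb).1
        (hle b' hb') h h' hz hw hx hy
    · exact not_rectangle_of_sub_eq_pow hk hn hY (hA₂ a' ha').1 (hA₂ a ha).2 (hB₃ b' hb').1
        (hle b hb) h h' hw hz hy hx)
  set E : ℕ := ((A₂ ×ˢ B₃).filter fun p => r p.1 p.2).card
  have hrectR : (E : ℝ) ^ 2 ≤ B₃.card * ((A₂.card : ℝ) ^ 2 + E) := by exact_mod_cast hrect
  rw [← Real.sqrt_eq_rpow, ← Real.sqrt_eq_rpow]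
  exact le_sqrt_two_mul_add_of_sq_le (Nat.cast_nonneg _) (Nat.cast_nonneg _) hrectR
end
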